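/- For every history h from v₀ in a parameterized arena, zip(h) is again a history from v₀, its last vertex equals last(h), no vertex occurs twice in zip(h), and zip(zip(h)) = zip(h). -/

import Mathlib

/-- The prefix of length `k` of an infinite word `w`. -/
def wordPrefix {A : Type*} (w : ℕ → A) (k : ℕ) : List A := (List.range k).map w

/-- The history `ρ 0, ρ 1, …, ρ j` of a play `ρ`. -/
def histUpTo {V : Type*} (ρ : ℕ → V) (j : ℕ) : List V := (List.range (j+1)).map ρ

/-- `h` is a history from `v₀`: nonempty, starts at `v₀`, and consecutive vertices
are linked by a nonempty transition language. -/
def IsHist {V A : Type*} (Δ : V → V → Set (List A)) (v₀ : V) (h : List V) : Prop :=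
  h ≠ [] ∧ h.head? = some v₀ ∧ List.Chain' (fun u w => (Δ u w).Nonempty) h

/-- Membership of the play `ρ` in the `k`-outcome of the coalition strategy `σ` from `v₀`. -/
def InOutcome {V A : Type*} (Δ : V → V → Set (List A)) (v₀ : V) (σ : List V → ℕ → A)
    (k : ℕ) (ρ : ℕ → V) : Prop :=
  ρ 0 = v₀ ∧ ∀ j : ℕ, wordPrefix (σ (histUpTo ρ j)) k ∈ Δ (ρ j) (ρ (j+1))

/-- The coalition strategy `σ` is winning from `v₀` for the safe set `S`. -/
def WinningFrom {V A : Type*} (Δ : V → V → Set (List A)) (S : Set V) (v₀ : V)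
    (σ : List V → ℕ → A) : Prop :=
  ∀ k : ℕ, 1 ≤ k → ∀ ρ : ℕ → V, InOutcome Δ v₀ σ k ρ → ∀ j : ℕ, ρ j ∈ S

/-- Auxiliary loop-erasure on reversed histories (most recent vertex first). -/
def zipAux {V : Type*} [DecidableEq V] : List V → List V
  | [] => []
  | v' :: rest =>
    let z := zipAux rest
    if v' ∈ z then z.dropWhile (fun x => decide (x ≠ v')) else v' :: z

/-- The loop-erasure map `zip` on histories. -/
def zip {V : Type*} [DecidableEq V] (h : List V) : List V := (zipAux h.reverse).reverse

/-- All words of the transition languages are nonempty. -/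
def NonemptyWords {V A : Type*} (Δ : V → V → Set (List A)) : Prop :=
  ∀ v w : V, ∀ u ∈ Δ v w, u ≠ ([] : List A)

/-- Completeness of the arena. -/
def CompleteArena {V A : Type*} (Δ : V → V → Set (List A)) : Prop :=
  ∀ v : V, ∀ u : List A, u ≠ [] → ∃ w : V, u ∈ Δ v w

/-- Every unsafe vertex is a sink. -/
def UnsafeSinks {V A : Type*} (Δ : V → V → Set (List A)) (S : Set V) : Prop :=
  ∀ v ∉ S, Δ v v = {u : List A | u ≠ []} ∧ ∀ w : V, w ≠ v → Δ v w = (∅ : Set (List A))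

/-- A language of finite words is regular if it is accepted by a DFA with finitely
many states. -/
def IsRegularLang {A : Type*} (L : Set (List A)) : Prop :=
  ∃ (Q : Type) (_ : Fintype Q) (M : DFA A Q), ∀ u : List A, u ∈ M.accepts ↔ u ∈ L

/-- The strategy `σ` uses the memory set `M`. -/
def UsesMemory {V A : Type*} (Δ : V → V → Set (List A)) (v₀ : V)
    (σ : List V → ℕ → A) (M : Type) : Prop :=
  ∃ (minit : M) (upd : M → V → M) (next : M → V → ℕ → A),
    ∀ h : List V, IsHist Δ v₀ h → σ h = next (h.tail.foldl upd minit) (h.getLastD v₀)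

theorem zipAux_cons {V : Type*} [DecidableEq V] (v : V) (l : List V) :
    zipAux (v :: l) = if v ∈ zipAux l then (zipAux l).dropWhile (fun x => decide (x ≠ v))
      else v :: zipAux l := rfl

/-- Dropping up to the first occurrence of `v` leaves a suffix starting with `v`. -/
theorem exists_dropWhile_ne_eq_cons {V : Type*} [DecidableEq V] {v : V} {z : List V}
    (hv : v ∈ z) : ∃ t, z.dropWhile (fun x => decide (x ≠ v)) = v :: t := by
  induction z with
  | nil => simp at hv
  | cons a z ih =>
    by_cases h : a = v
    · exact ⟨z, by simp [h]⟩
    · have hz : v ∈ z := by simpa [Ne.symm h] using hv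
      simpa [List.dropWhile_cons, h] using ih hz

theorem head?_zipAux {V : Type*} [DecidableEq V] (l : List V) :
    (zipAux l).head? = l.head? := by
  cases l with
  | nil => rfl
  | cons v l =>
    rw [zipAux_cons]
    split_ifs with hv
    · obtain ⟨t, ht⟩ := exists_dropWhile_ne_eq_cons hv
      rw [ht]
      rfl
    · rfl

theorem getLast?_zipAux {V : Type*} [DecidableEq V] (l : List V) :
    (zipAux l).getLast? = l.getLast? := by
  induction l with
  | nil => rfl
  | cons v l ih =>
    rw [zipAux_cons]
    split_ifs with hv
    · obtain ⟨t, ht⟩ := exists_dropWhile_ne_eq_cons hv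
      obtain ⟨s, hs⟩ := List.dropWhile_suffix (l := zipAux l) (fun x => decide (x ≠ v))
      rw [ht] at hs
      have hl : l ≠ [] := by
        rintro rfl
        simp [zipAux] at hv
      rw [List.getLast?_cons_of_ne_nil hl, ← ih, ht, ← hs,
        List.getLast?_append_of_ne_nil s (List.cons_ne_nil v t)]
    · simp [List.getLast?_cons, ih]

theorem nodup_zipAux {V : Type*} [DecidableEq V] (l : List V) : (zipAux l).Nodup := by
  induction l with
  | nil => exact List.nodup_nil
  | cons v l ih =>
    rw [zipAux_cons]
    split_ifs with hv
    · exact ih.sublist (List.dropWhile_suffix _).sublist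
    · exact List.nodup_cons.2 ⟨hv, ih⟩

theorem isChain_zipAux {V : Type*} [DecidableEq V] {R : V → V → Prop} {l : List V}
    (h : l.IsChain R) : (zipAux l).IsChain R := by
  induction l with
  | nil => exact List.isChain_nil
  | cons v l ih =>
    rw [List.isChain_cons] at h
    rw [zipAux_cons]
    split_ifs with hv
    · exact (ih h.2).suffix (List.dropWhile_suffix _)
    · exact List.isChain_cons.2 ⟨by simpa only [head?_zipAux] using h.1, ih h.2⟩

theorem zipAux_eq_self {V : Type*} [DecidableEq V] {l : List V} (h : l.Nodup) :
    zipAux l = l := by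
  induction l with
  | nil => rfl
  | cons v l ih =>
    rw [List.nodup_cons] at h
    rw [zipAux_cons, ih h.2, if_neg h.1]

/-- for every history `h` from `v₀`, `zip h` is again a history from `v₀`,
its last vertex equals the last vertex of `h`, no vertex occurs twice in `zip h`,
and `zip (zip h) = zip h`. -/
theorem stmt1 {V A : Type} [Fintype V] [DecidableEq V] [Fintype A]
    (Δ : V → V → Set (List A)) (v₀ : V)
    (h : List V) (hh : IsHist Δ v₀ h) :
    IsHist Δ v₀ (zip h) ∧ (zip h).getLast? = h.getLast? ∧ (zip h).Nodup ∧
      zip (zip h) = zip h := by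
  obtain ⟨hne, hhead, hchain⟩ := hh
  have hz : (zip h).head? = some v₀ := by
    rw [zip, List.head?_reverse, getLast?_zipAux, List.getLast?_reverse, hhead]
  refine ⟨⟨?_, hz, ?_⟩, ?_, ?_, ?_⟩
  · intro h0
    simp [h0] at hz
  · exact List.isChain_reverse.2 (isChain_zipAux (List.isChain_reverse.2 hchain))
  · rw [zip, List.getLast?_reverse, head?_zipAux, List.head?_reverse]
  · exact List.nodup_reverse.2 (nodup_zipAux _)
  · simp only [zip, List.reverse_reverse, zipAux_eq_self (nodup_zipAux _)]
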